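/- Let 0 ≤ α ≤ β < ω₁ and let X be a topological space. Then every α-embedded subset of X is also β-embedded in X. -/

import Mathlib

open Set

universe u v

/-- `A` is functionally open in `X`: `A = f⁻¹((0,1])` for some continuous `f : X → [0,1]`. -/
def FunctionallyOpen (X : Type u) [TopologicalSpace X] (A : Set X) : Prop :=
  ∃ f : X → ℝ, Continuous f ∧ (∀ x, f x ∈ Set.Icc (0:ℝ) 1) ∧ A = f ⁻¹' (Set.Ioc 0 1)

/-- `A` is functionally closed in `X`: `A = f⁻¹(0)` for some continuous `f : X → [0,1]`. -/
def FunctionallyClosed (X : Type u) [TopologicalSpace X] (A : Set X) : Prop :=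
  ∃ f : X → ℝ, Continuous f ∧ (∀ x, f x ∈ Set.Icc (0:ℝ) 1) ∧ A = f ⁻¹' {0}

mutual
/-- The `α`'th functionally additive class in `X`. -/
inductive FunAdd (X : Type u) [TopologicalSpace X] : Ordinal.{0} → Set X → Prop where
  | base (A : Set X) : FunctionallyOpen X A → FunAdd X 0 A
  | union (α : Ordinal.{0}) (hα : α ≠ 0) (β : ℕ → Ordinal.{0}) (hβ : ∀ n, β n < α)
      (s : ℕ → Set X) (hs : ∀ n, FunMul X (β n) (s n)) : FunAdd X α (⋃ n, s n)

/-- The `α`'th functionally multiplicative class in `X`. -/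
inductive FunMul (X : Type u) [TopologicalSpace X] : Ordinal.{0} → Set X → Prop where
  | base (A : Set X) : FunctionallyClosed X A → FunMul X 0 A
  | inter (α : Ordinal.{0}) (hα : α ≠ 0) (β : ℕ → Ordinal.{0}) (hβ : ∀ n, β n < α)
      (s : ℕ → Set X) (hs : ∀ n, FunAdd X (β n) (s n)) : FunMul X α (⋂ n, s n)
end

mutual
/-- The `α`'th (ordinary) additive Borel class in `X`. -/
inductive BorelAdd (X : Type u) [TopologicalSpace X] : Ordinal.{0} → Set X → Prop where
  | base (A : Set X) : IsOpen A → BorelAdd X 0 A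
  | union (α : Ordinal.{0}) (hα : α ≠ 0) (β : ℕ → Ordinal.{0}) (hβ : ∀ n, β n < α)
      (s : ℕ → Set X) (hs : ∀ n, BorelMul X (β n) (s n)) : BorelAdd X α (⋃ n, s n)

/-- The `α`'th (ordinary) multiplicative Borel class in `X`. -/
inductive BorelMul (X : Type u) [TopologicalSpace X] : Ordinal.{0} → Set X → Prop where
  | base (A : Set X) : IsClosed A → BorelMul X 0 A
  | inter (α : Ordinal.{0}) (hα : α ≠ 0) (β : ℕ → Ordinal.{0}) (hβ : ∀ n, β n < α)
      (s : ℕ → Set X) (hs : ∀ n, BorelAdd X (β n) (s n)) : BorelMul X α (⋂ n, s n)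
end

/-- A set is functionally ambiguous of class `α` if it belongs to both the `α`'th functionally
additive and the `α`'th functionally multiplicative class. -/
def FunAmbiguous (X : Type u) [TopologicalSpace X] (α : Ordinal.{0}) (A : Set X) : Prop :=
  FunAdd X α A ∧ FunMul X α A

/-- `f ∈ K_α(X,Y)`: for `α = 0` continuity, for `α > 0` preimages of open sets belong to
the `α`'th functionally additive class. -/
def KClass {X : Type u} {Y : Type v} [TopologicalSpace X] [TopologicalSpace Y]
    (α : Ordinal.{0}) (f : X → Y) : Prop :=
  (α = 0 → Continuous f) ∧ (α ≠ 0 → ∀ V : Set Y, IsOpen V → FunAdd X α (f ⁻¹' V))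

/-- `A` and `B` are `α`-separated in `X`. -/
def AlphaSeparated {X : Type u} [TopologicalSpace X] (α : Ordinal.{0}) (A B : Set X) : Prop :=
  ∃ f : X → ℝ, KClass α f ∧ A ⊆ f ⁻¹' {0} ∧ B ⊆ f ⁻¹' {1}

/-- `X` is an `α`-separated space: any two disjoint sets of the `α`'th (ordinary)
multiplicative class are `α`-separated. -/
def AlphaSeparatedSpace (X : Type u) [TopologicalSpace X] (α : Ordinal.{0}) : Prop :=
  ∀ A B : Set X, BorelMul X α A → BorelMul X α B → Disjoint A B → AlphaSeparated α A B

/-- `E` is `α`-embedded in `X`. -/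
def AlphaEmbedded {X : Type u} [TopologicalSpace X] (α : Ordinal.{0}) (E : Set X) : Prop :=
  (∀ A : Set ↥E, FunAdd ↥E α A → ∃ B : Set X, FunAdd X α B ∧ Subtype.val '' A = B ∩ E) ∧
  (∀ A : Set ↥E, FunMul ↥E α A → ∃ B : Set X, FunMul X α B ∧ Subtype.val '' A = B ∩ E)

/-- `E` is ambiguously `α`-embedded in `X`. -/
def AmbiguouslyEmbedded {X : Type u} [TopologicalSpace X] (α : Ordinal.{0}) (E : Set X) : Prop :=
  ∀ A : Set ↥E, FunAmbiguous ↥E α A →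
    ∃ B : Set X, FunAmbiguous X α B ∧ Subtype.val '' A = B ∩ E

/-- The first uncountable ordinal. -/
noncomputable def omega1 : Ordinal.{0} := (Cardinal.aleph 1).ord

/-- `A` is an `F_σ`-set: a countable union of closed sets. -/
def IsFSigma {X : Type u} [TopologicalSpace X] (A : Set X) : Prop :=
  ∃ F : ℕ → Set X, (∀ n, IsClosed (F n)) ∧ A = ⋃ n, F n

/-- A space has a countable π-base. -/
def CountablePiBase (Z : Type v) [TopologicalSpace Z] : Prop :=
  ∃ 𝒰 : Set (Set Z), 𝒰.Countable ∧ (∀ U ∈ 𝒰, IsOpen U ∧ U.Nonempty) ∧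
    ∀ V : Set Z, IsOpen V → V.Nonempty → ∃ U ∈ 𝒰, U ⊆ V

theorem aux_closed {X : Type u} [TopologicalSpace X] (f : X → ℝ) (hf : Continuous f)
    (h : ∀ x, f x ∈ Set.Icc (0:ℝ) 1) (n : ℕ) :
    FunctionallyOpen X {x | f x < 1 / ((n:ℝ) + 1)} ∧
    FunctionallyClosed X {x | 1 / ((n:ℝ) + 1) ≤ f x} := by
  have h1 : (1:ℝ) / ((n:ℝ) + 1) ≤ 1 := by
    rw [div_le_one (by positivity)]
    have : (0:ℝ) ≤ n := Nat.cast_nonneg n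
    linarith
  have hc : Continuous (fun x => max (1 / ((n:ℝ) + 1) - f x) 0) := by fun_prop
  have hb : ∀ x, max (1 / ((n:ℝ) + 1) - f x) 0 ∈ Set.Icc (0:ℝ) 1 := by
    intro x
    refine ⟨le_max_right _ _, max_le ?_ zero_le_one⟩
    have := (h x).1
    linarith
  refine ⟨⟨_, hc, hb, ?_⟩, ⟨_, hc, hb, ?_⟩⟩
  · ext x
    simp only [mem_setOf_eq, mem_preimage, mem_Ioc]
    constructor
    · intro hx
      exact ⟨lt_max_of_lt_left (by linarith), (hb x).2⟩
    · rintro ⟨hx, -⟩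
      rcases lt_max_iff.1 hx with hx | hx
      · linarith
      · exact absurd hx (lt_irrefl _)
  · ext x
    simp only [mem_setOf_eq, mem_preimage, mem_singleton_iff, max_eq_right_iff, sub_nonpos]

theorem aux_mul_mono {X : Type u} [TopologicalSpace X] {γ δ : Ordinal.{0}} (h : γ ≤ δ)
    {A : Set X} (hA : FunMul X γ A) : FunMul X δ A := by
  cases hA with
  | base _ hA =>
    by_cases hδ : δ = 0
    · subst hδ
      exact FunMul.base _ hA
    obtain ⟨f, hf, hb, rfl⟩ := hA
    have e : f ⁻¹' {0} = ⋂ n : ℕ, {x | f x < 1 / ((n:ℝ) + 1)} := by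
      ext x
      simp only [mem_preimage, mem_singleton_iff, mem_iInter, mem_setOf_eq]
      constructor
      · intro hx n
        rw [hx]
        positivity
      · intro hx
        by_contra hne
        have hp : 0 < f x := lt_of_le_of_ne (hb x).1 (Ne.symm hne)
        obtain ⟨n, hn⟩ := exists_nat_one_div_lt hp
        exact lt_asymm hn (hx n)
    rw [e]
    exact FunMul.inter δ hδ (fun _ => 0) (fun _ => pos_iff_ne_zero.2 hδ) _
      (fun n => FunAdd.base _ (aux_closed f hf hb n).1)
  | inter _ hγ b hb s hs =>
    exact FunMul.inter δ (fun h0 => hγ (le_antisymm (h0 ▸ h) (zero_le))) b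
      (fun n => (hb n).trans_le h) s hs

theorem aux_add_mono {X : Type u} [TopologicalSpace X] {γ δ : Ordinal.{0}} (h : γ ≤ δ)
    {A : Set X} (hA : FunAdd X γ A) : FunAdd X δ A := by
  cases hA with
  | base _ hA =>
    by_cases hδ : δ = 0
    · subst hδ
      exact FunAdd.base _ hA
    obtain ⟨f, hf, hb, rfl⟩ := hA
    have e : f ⁻¹' (Set.Ioc 0 1) = ⋃ n : ℕ, {x | 1 / ((n:ℝ) + 1) ≤ f x} := by
      ext x
      simp only [mem_preimage, mem_Ioc, mem_iUnion, mem_setOf_eq]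
      constructor
      · rintro ⟨hp, -⟩
        obtain ⟨n, hn⟩ := exists_nat_one_div_lt hp
        exact ⟨n, hn.le⟩
      · rintro ⟨n, hn⟩
        exact ⟨lt_of_lt_of_le (by positivity) hn, (hb x).2⟩
    rw [e]
    exact FunAdd.union δ hδ (fun _ => 0) (fun _ => pos_iff_ne_zero.2 hδ) _
      (fun n => FunMul.base _ (aux_closed f hf hb n).2)
  | union _ hγ b hb s hs =>
    exact FunAdd.union δ (fun h0 => hγ (le_antisymm (h0 ▸ h) (zero_le))) b
      (fun n => (hb n).trans_le h) s hs

theorem aux_main {X : Type u} [TopologicalSpace X] (α : Ordinal.{0}) (E : Set X)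
    (hE : AlphaEmbedded α E) (β : Ordinal.{0}) : α ≤ β → AlphaEmbedded β E := by
  induction β using WellFoundedLT.induction with
  | ind β ih =>
  intro hαβ
  rcases hαβ.eq_or_lt with rfl | hlt
  · exact hE
  have hβ0 : β ≠ 0 := (lt_of_le_of_lt (zero_le) hlt).ne'
  constructor
  · intro A hA
    cases hA with
    | base _ hA => exact absurd rfl hβ0
    | union _ _ b hb s hs =>
      have key : ∀ n, ∃ B : Set X, FunMul X (max α (b n)) B ∧ Subtype.val '' (s n) = B ∩ E :=
        fun n => (ih _ (max_lt hlt (hb n)) (le_max_left _ _)).2 _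
          (aux_mul_mono (le_max_right _ _) (hs n))
      choose B hB hBE using key
      refine ⟨⋃ n, B n, FunAdd.union β hβ0 _ (fun n => max_lt hlt (hb n)) B hB, ?_⟩
      rw [image_iUnion, iUnion_inter]
      exact iUnion_congr hBE
  · intro A hA
    cases hA with
    | base _ hA => exact absurd rfl hβ0
    | inter _ _ b hb s hs =>
      have key : ∀ n, ∃ B : Set X, FunAdd X (max α (b n)) B ∧ Subtype.val '' (s n) = B ∩ E :=
        fun n => (ih _ (max_lt hlt (hb n)) (le_max_left _ _)).1 _
          (aux_add_mono (le_max_right _ _) (hs n))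
      choose B hB hBE using key
      refine ⟨⋂ n, B n, FunMul.inter β hβ0 _ (fun n => max_lt hlt (hb n)) B hB, ?_⟩
      rw [iInter_inter, Subtype.val_injective.injOn.image_iInter_eq]
      exact iInter_congr hBE

/-- if `0 ≤ α ≤ β < ω₁`, then every `α`-embedded subset of `X` is `β`-embedded. -/
theorem stmt0 {X : Type u} [TopologicalSpace X] (α β : Ordinal.{0})
    (hβ : β < omega1) (hαβ : α ≤ β) (E : Set X) (hE : AlphaEmbedded α E) :
    AlphaEmbedded β E := by
  exact aux_main α E hE β hαβ
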